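/- Suppose the grid functions U^0, U^1, …, U^N (each defined on {0,…,M_x}×{0,…,M_y} and vanishing for i ∈ {0, M_x} or j ∈ {0, M_y}) satisfy the implicit finite difference scheme: for all 1 ≤ i ≤ M_x−1, 1 ≤ j ≤ M_y−1 and 1 ≤ n ≤ N, Σ_{l=1}^{p} a_l μ_{1,l} [ a_0^{(γ_l)} ∇_t U_{ij}^n − Σ_{k=1}^{n−1} (a_{n−k−1}^{(γ_l)} − a_{n−k}^{(γ_l)}) ∇_t U_{ij}^k − a_{n−1}^{(γ_l)} φ_{ij} ] + b_1 ∇_t U_{ij}^n + Σ_{m=1}^{q} c_m μ_{2,m} Σ_{k=1}^{n} c_{n−k}^{(n,α_m)} ∇_t U_{ij}^k + b_2 U_{ij}^{n−1/2} = b_3 (δ_x^2 + δ_y^2) U_{ij}^{n−1/2} + Σ_{r=1}^{s} d_r μ_{3,r} Σ_{k=1}^{n} c_{n−k}^{(n,β_r)} ∇_t (δ_x^2 + δ_y^2) U_{ij}^k + f_{ij}^{n−1/2}, where φ and the f^{n−1/2} are given grid functions. Then b_2 ‖U^N‖_0^2 + b_3 |U^N|_1^2 ≤ b_2 ‖U^0‖_0^2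 + b_3 |U^0|_1^2 + Σ_{l=1}^{p} (a_l T^{2−γ_l}/Γ(3−γ_l)) ‖φ‖_0^2 + ( T / ( Σ_{l=1}^{p} a_l T^{1−γ_l}/Γ(2−γ_l) + 2 b_1 ) ) · max_{1 ≤ n ≤ N} ‖f^{n−1/2}‖_0^2. In particular the scheme is unconditionally stable. -/

import Mathlib

/-- `a`-coefficients for `α ∈ (0,1)`:
`a_0 = (1/2)^(1-α)`, `a_k = (k+1/2)^(1-α) - (k-1/2)^(1-α)` for `k ≥ 1`. -/
noncomputable def aC (α : ℝ) (k : ℕ) : ℝ :=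
  if k = 0 then (1 / 2 : ℝ) ^ (1 - α)
  else ((k : ℝ) + 1 / 2) ^ (1 - α) - ((k : ℝ) - 1 / 2) ^ (1 - α)

/-- `b`-coefficients for `α ∈ (0,1)`, `k ≥ 1`. -/
noncomputable def bC (α : ℝ) (k : ℕ) : ℝ :=
  (1 / (2 - α)) * (((k : ℝ) + 1 / 2) ^ (2 - α) - ((k : ℝ) - 1 / 2) ^ (2 - α))
    - (1 / 2) * (((k : ℝ) + 1 / 2) ^ (1 - α) + ((k : ℝ) - 1 / 2) ^ (1 - α))

/-- `c`-coefficients at time level `n`: for `n = 1`, `c_0 = a_0`; for `n ≥ 2`,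
`c_0 = a_0 + b_1`, `c_k = a_k + b_{k+1} - b_k` for `1 ≤ k ≤ n-2`, and
`c_{n-1} = a_{n-1} - b_{n-1}`. -/
noncomputable def cC (α : ℝ) (n k : ℕ) : ℝ :=
  if n ≤ 1 then aC α k
  else if k = 0 then aC α 0 + bC α 1
  else if k = n - 1 then aC α (n - 1) - bC α (n - 1)
  else aC α k + bC α (k + 1) - bC α k

/-- Coefficients for `γ ∈ (1,2)`: `a_k^{(γ)} = (k+1)^(2-γ) - k^(2-γ)`. -/
noncomputable def aG (γ : ℝ) (k : ℕ) : ℝ :=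
  ((k : ℝ) + 1) ^ (2 - γ) - (k : ℝ) ^ (2 - γ)

/-- Discrete Laplacian `(δ_x² + δ_y²) v` at the grid point `(i, j)`. -/
noncomputable def discLap (hx hy : ℝ) (v : ℕ → ℕ → ℝ) (i j : ℕ) : ℝ :=
  (v (i - 1) j - 2 * v i j + v (i + 1) j) / hx ^ 2
    + (v i (j - 1) - 2 * v i j + v i (j + 1)) / hy ^ 2

/-- Squared discrete `L²` norm `‖v‖₀² = hx hy ∑_{i=1}^{Mx-1} ∑_{j=1}^{My-1} v_{ij}²`. -/
noncomputable def norm0sq (hx hy : ℝ) (Mx My : ℕ) (v : ℕ → ℕ → ℝ) : ℝ :=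
  hx * hy * ∑ i ∈ Finset.Icc 1 (Mx - 1), ∑ j ∈ Finset.Icc 1 (My - 1), (v i j) ^ 2

/-- Squared discrete `H¹` seminorm `|v|₁²`. -/
noncomputable def semi1sq (hx hy : ℝ) (Mx My : ℕ) (v : ℕ → ℕ → ℝ) : ℝ :=
  hx * hy *
    ((∑ i ∈ Finset.Icc 1 Mx, ∑ j ∈ Finset.Icc 1 (My - 1), ((v i j - v (i - 1) j) / hx) ^ 2)
      + ∑ i ∈ Finset.Icc 1 (Mx - 1), ∑ j ∈ Finset.Icc 1 My, ((v i j - v i (j - 1)) / hy) ^ 2)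


lemma sum_Icc_one_sub_pred (C : ℕ → ℝ) (n : ℕ) :
    ∑ k ∈ Finset.Icc 1 n, (C k - C (k - 1)) = C n - C 0 := by
  induction n with
  | zero => simp
  | succ n ih => rw [Finset.sum_Icc_succ_top (by omega), ih]; simp

/-- Abel summation against the tail sums of `v`. -/
lemma sum_mul_eq_sum_sub_mul_tail (C v : ℕ → ℝ) (hC : C 0 = 0) (n : ℕ) :
    ∑ k ∈ Finset.Icc 1 n, C k * v k
      = ∑ k ∈ Finset.Icc 1 n, (C k - C (k - 1)) * ∑ i ∈ Finset.Icc k n, v i := by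
  induction n with
  | zero => simp
  | succ n ih =>
    rw [Finset.sum_Icc_succ_top (by omega), Finset.sum_Icc_succ_top (by omega), ih]
    have h : ∀ k ∈ Finset.Icc 1 n, (C k - C (k - 1)) * ∑ i ∈ Finset.Icc k (n + 1), v i
        = (C k - C (k - 1)) * (∑ i ∈ Finset.Icc k n, v i) + (C k - C (k - 1)) * v (n + 1) := by
      intro k hk
      rw [Finset.mem_Icc] at hk
      rw [Finset.sum_Icc_succ_top (by omega)]
      ring
    rw [Finset.sum_congr rfl h, Finset.sum_add_distrib, ← Finset.sum_mul,
      sum_Icc_one_sub_pred, hC]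
    simp
    ring

/-- A two-dimensional Pólya-type criterion: a lower-triangular quadratic form is nonnegative if
the second mixed differences of its symmetrized coefficients are. -/
lemma sum_mul_sum_nonneg_of_mixed_diff (C T : ℕ → ℕ → ℝ) (v : ℕ → ℝ)
    (hC : ∀ n, C 0 n = 0) (hT : ∀ k n, k < n → T k n = C k n) (hTd : ∀ n, T n n = 2 * C n n)
    (hpos : ∀ k n, 1 ≤ k → k ≤ n → T (k - 1) n ≤ T k n)
    (hmix : ∀ k n, 1 ≤ k → k ≤ n → T k (n + 1) - T (k - 1) (n + 1) ≤ T k n - T (k - 1) n)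
    (N : ℕ) :
    0 ≤ ∑ n ∈ Finset.Icc 1 N, v n * ∑ k ∈ Finset.Icc 1 n, C k n * v k := by
  have key : ∀ N, ∑ k ∈ Finset.Icc 1 N, (T k N - T (k - 1) N) * (∑ i ∈ Finset.Icc k N, v i) ^ 2
      ≤ 2 * ∑ n ∈ Finset.Icc 1 N, v n * ∑ k ∈ Finset.Icc 1 n, C k n * v k := by
    intro N
    induction N with
    | zero => simp
    | succ n ih =>
      rw [Finset.sum_Icc_succ_top (by omega),
        Finset.sum_Icc_succ_top (by omega) (fun n => v n * ∑ k ∈ Finset.Icc 1 n, C k n * v k),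
        sum_mul_eq_sum_sub_mul_tail (fun k => C k (n + 1)) v (hC _),
        Finset.sum_Icc_succ_top (by omega) (fun k => (C k (n + 1) - C (k - 1) (n + 1)) *
          ∑ i ∈ Finset.Icc k (n + 1), v i)]
      have hstep : ∑ k ∈ Finset.Icc 1 n, (T k (n + 1) - T (k - 1) (n + 1)) *
            (∑ i ∈ Finset.Icc k (n + 1), v i) ^ 2
          ≤ ∑ k ∈ Finset.Icc 1 n, ((T k n - T (k - 1) n) * (∑ i ∈ Finset.Icc k n, v i) ^ 2
            + 2 * v (n + 1) * ((C k (n + 1) - C (k - 1) (n + 1)) *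
                ∑ i ∈ Finset.Icc k (n + 1), v i)
            - v (n + 1) ^ 2 * (C k (n + 1) - C (k - 1) (n + 1))) := by
        refine Finset.sum_le_sum fun k hk => ?_
        rw [Finset.mem_Icc] at hk
        rw [Finset.sum_Icc_succ_top (by omega), ← hT k (n + 1) (by omega),
          ← hT (k - 1) (n + 1) (by omega)]
        nlinarith [mul_nonneg (sub_nonneg.2 (hmix k n hk.1 hk.2))
          (sq_nonneg (∑ i ∈ Finset.Icc k n, v i))]
      rw [Finset.sum_sub_distrib, Finset.sum_add_distrib, ← Finset.mul_sum, ← Finset.mul_sum,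
        sum_Icc_one_sub_pred (fun k => C k (n + 1)), hC] at hstep
      simp only [Finset.Icc_self, Finset.sum_singleton, Nat.add_sub_cancel]
      rw [hTd, hT n (n + 1) (by omega)]
      nlinarith [hstep, ih]
  have h := key N
  have h' : 0 ≤ ∑ k ∈ Finset.Icc 1 N, (T k N - T (k - 1) N) *
      (∑ i ∈ Finset.Icc k N, v i) ^ 2 := by
    refine Finset.sum_nonneg fun k hk => ?_
    rw [Finset.mem_Icc] at hk
    exact mul_nonneg (sub_nonneg.2 (hpos k N hk.1 hk.2)) (sq_nonneg _)
  linarith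

/-- Discrete energy bound for an L1-type convolution with nonincreasing kernel `w`. -/
lemma sum_sq_le_sum_convolution (w v : ℕ → ℝ) (φ : ℝ) (hanti : ∀ k, w (k + 1) ≤ w k)
    (hpos : ∀ k, 0 ≤ w k) (N : ℕ) :
    ∑ k ∈ Finset.Icc 1 N, w (N - k) * v k ^ 2 - (∑ n ∈ Finset.Icc 1 N, w (n - 1)) * φ ^ 2
      ≤ ∑ n ∈ Finset.Icc 1 N, 2 * v n * (w 0 * v n
          - (∑ k ∈ Finset.Icc 1 (n - 1), (w (n - k - 1) - w (n - k)) * v k) - w (n - 1) * φ) := by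
  induction N with
  | zero => simp
  | succ n ih =>
    rw [Finset.sum_Icc_succ_top (by omega), Finset.sum_Icc_succ_top (by omega),
      Finset.sum_Icc_succ_top (by omega)]
    have tele : ∀ m ≤ n, ∑ k ∈ Finset.Icc 1 m, (w (n + 1 - k - 1) - w (n + 1 - k))
        = w (n - m) - w n := by
      intro m
      induction m with
      | zero => simp
      | succ m ih =>
        intro hm
        rw [Finset.sum_Icc_succ_top (by omega), ih (by omega),
          show n + 1 - (m + 1) - 1 = n - (m + 1) by omega, show n + 1 - (m + 1) = n - m by omega]
        ring
    have h : ∑ k ∈ Finset.Icc 1 n, 2 * v (n + 1) * ((w (n + 1 - k - 1) - w (n + 1 - k)) * v k)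
        ≤ ∑ k ∈ Finset.Icc 1 n, (w (n - k) * v k ^ 2 - w (n + 1 - k) * v k ^ 2
            + v (n + 1) ^ 2 * (w (n + 1 - k - 1) - w (n + 1 - k))) := by
      refine Finset.sum_le_sum fun k hk => ?_
      rw [Finset.mem_Icc] at hk
      rw [show n + 1 - k = (n - k) + 1 by omega, Nat.add_sub_cancel]
      nlinarith [mul_nonneg (sub_nonneg.2 (hanti (n - k))) (sq_nonneg (v k - v (n + 1)))]
    rw [Finset.sum_add_distrib, Finset.sum_sub_distrib, ← Finset.mul_sum, ← Finset.mul_sum,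
      tele n le_rfl] at h
    simp only [Nat.add_sub_cancel, Nat.sub_self] at h ⊢
    nlinarith [mul_nonneg (hpos n) (sq_nonneg (v (n + 1) - φ))]

/-- One-dimensional summation by parts for the second difference. -/
lemma sum_second_diff_mul (u v : ℕ → ℝ) (M : ℕ) (hM : 1 ≤ M) (h0 : v 0 = 0) (h1 : v M = 0) :
    ∑ i ∈ Finset.Icc 1 (M - 1), (u (i - 1) - 2 * u i + u (i + 1)) * v i
      = -∑ i ∈ Finset.Icc 1 M, (u i - u (i - 1)) * (v i - v (i - 1)) := by
  obtain ⟨m, rfl⟩ : ∃ m, M = m + 1 := ⟨M - 1, by omega⟩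
  have key : ∀ m, ∑ i ∈ Finset.Icc 1 m, (u (i - 1) - 2 * u i + u (i + 1)) * v i
      = (u (m + 1) - u m) * v m
        - ∑ i ∈ Finset.Icc 1 m, (u i - u (i - 1)) * (v i - v (i - 1)) := by
    intro m
    induction m with
    | zero => simp [h0]
    | succ m ih =>
      rw [Finset.sum_Icc_succ_top (by omega), Finset.sum_Icc_succ_top (by omega), ih]
      simp only [Nat.add_sub_cancel]
      ring
  rw [Finset.sum_Icc_succ_top (by omega), Nat.add_sub_cancel, key, h1]
  ring

/-- The bilinear form whose diagonal is the (unweighted) discrete `H¹` seminorm. -/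
noncomputable def dirichletForm (hx hy : ℝ) (Mx My : ℕ) (u v : ℕ → ℕ → ℝ) : ℝ :=
  (∑ i ∈ Finset.Icc 1 Mx, ∑ j ∈ Finset.Icc 1 (My - 1),
      ((u i j - u (i - 1) j) / hx) * ((v i j - v (i - 1) j) / hx))
    + ∑ i ∈ Finset.Icc 1 (Mx - 1), ∑ j ∈ Finset.Icc 1 My,
      ((u i j - u i (j - 1)) / hy) * ((v i j - v i (j - 1)) / hy)

lemma semi1sq_eq_dirichletForm (hx hy : ℝ) (Mx My : ℕ) (v : ℕ → ℕ → ℝ) :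
    semi1sq hx hy Mx My v = hx * hy * dirichletForm hx hy Mx My v v := by
  simp only [semi1sq, dirichletForm, sq]

lemma dirichletForm_avg_diff (hx hy τ : ℝ) (Mx My : ℕ) (u w : ℕ → ℕ → ℝ) (hτ : τ ≠ 0) :
    2 * τ * dirichletForm hx hy Mx My (fun i j => (u i j + w i j) / 2)
        (fun i j => (u i j - w i j) / τ)
      = dirichletForm hx hy Mx My u u - dirichletForm hx hy Mx My w w := by
  simp only [dirichletForm, mul_add, Finset.mul_sum]
  rw [add_sub_add_comm, ← Finset.sum_sub_distrib, ← Finset.sum_sub_distrib]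
  simp only [← Finset.sum_sub_distrib]
  congr 1 <;>
  · refine Finset.sum_congr rfl fun i _ => Finset.sum_congr rfl fun j _ => ?_
    field_simp
    ring

/-- Discrete Green identity on the grid. -/
lemma sum_discLap_mul (hx hy : ℝ) (Mx My : ℕ) (hMx : 1 ≤ Mx) (hMy : 1 ≤ My) (u v : ℕ → ℕ → ℝ)
    (hv : ∀ i j : ℕ, (i = 0 ∨ i = Mx ∨ j = 0 ∨ j = My) → v i j = 0) :
    ∑ i ∈ Finset.Icc 1 (Mx - 1), ∑ j ∈ Finset.Icc 1 (My - 1), discLap hx hy u i j * v i j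
      = -dirichletForm hx hy Mx My u v := by
  have hX : ∑ i ∈ Finset.Icc 1 (Mx - 1), ∑ j ∈ Finset.Icc 1 (My - 1),
        (u (i - 1) j - 2 * u i j + u (i + 1) j) / hx ^ 2 * v i j
      = -∑ i ∈ Finset.Icc 1 Mx, ∑ j ∈ Finset.Icc 1 (My - 1),
            ((u i j - u (i - 1) j) / hx) * ((v i j - v (i - 1) j) / hx) := by
    rw [Finset.sum_comm, Finset.sum_comm (s := Finset.Icc 1 Mx), ← Finset.sum_neg_distrib]
    refine Finset.sum_congr rfl fun j _ => ?_
    have h := sum_second_diff_mul (fun i => u i j) (fun i => v i j) Mx hMx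
      (hv _ _ (by simp)) (hv _ _ (by simp))
    calc _ = (∑ i ∈ Finset.Icc 1 (Mx - 1),
              (u (i - 1) j - 2 * u i j + u (i + 1) j) * v i j) / hx ^ 2 := by
            rw [Finset.sum_div]; exact Finset.sum_congr rfl fun i _ => by ring
      _ = _ := by
            rw [h, neg_div, Finset.sum_div]
            congr 1
            exact Finset.sum_congr rfl fun i _ => by ring
  have hY : ∑ i ∈ Finset.Icc 1 (Mx - 1), ∑ j ∈ Finset.Icc 1 (My - 1),
        (u i (j - 1) - 2 * u i j + u i (j + 1)) / hy ^ 2 * v i j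
      = -∑ i ∈ Finset.Icc 1 (Mx - 1), ∑ j ∈ Finset.Icc 1 My,
            ((u i j - u i (j - 1)) / hy) * ((v i j - v i (j - 1)) / hy) := by
    rw [← Finset.sum_neg_distrib]
    refine Finset.sum_congr rfl fun i _ => ?_
    have h := sum_second_diff_mul (fun j => u i j) (fun j => v i j) My hMy
      (hv _ _ (by simp)) (hv _ _ (by simp))
    calc _ = (∑ j ∈ Finset.Icc 1 (My - 1),
              (u i (j - 1) - 2 * u i j + u i (j + 1)) * v i j) / hy ^ 2 := by
            rw [Finset.sum_div]; exact Finset.sum_congr rfl fun i _ => by ring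
      _ = _ := by
            rw [h, neg_div, Finset.sum_div]
            congr 1
            exact Finset.sum_congr rfl fun i _ => by ring
  rw [dirichletForm, neg_add, ← hX, ← hY, ← Finset.sum_add_distrib]
  refine Finset.sum_congr rfl fun i _ => ?_
  rw [← Finset.sum_add_distrib]
  exact Finset.sum_congr rfl fun j _ => by rw [discLap]; ring

/-- Midpoint convexity of a negative power. -/
lemma rpow_neg_second_diff_nonneg {r s : ℝ} (hr : 0 < r) (hs : 0 < s) :
    0 ≤ s ^ (-r) - 2 * (s + 1) ^ (-r) + (s + 2) ^ (-r) := by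
  have h1 : ((s + 1) ^ (-r)) ^ 2 ≤ s ^ (-r) * (s + 2) ^ (-r) := by
    rw [← Real.mul_rpow hs.le (by linarith), sq, ← Real.mul_rpow (by linarith) (by linarith)]
    exact Real.rpow_le_rpow_of_nonpos (by positivity) (by nlinarith) (by linarith)
  have h2 : 0 < s ^ (-r) := by positivity
  have h3 : 0 < (s + 1) ^ (-r) := by positivity
  have h4 : 0 < (s + 2) ^ (-r) := by positivity
  nlinarith [sq_nonneg (s ^ (-r) - (s + 2) ^ (-r)),
    abs_le_of_sq_le_sq' (a := 2 * (s + 1) ^ (-r)) (b := s ^ (-r) + (s + 2) ^ (-r))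
      (by nlinarith [sq_nonneg (s ^ (-r) - (s + 2) ^ (-r))]) (by positivity)]

lemma rpow_neg_antitoneOn {r : ℝ} (hr : 0 < r) :
    AntitoneOn (fun s : ℝ => s ^ (-r)) (Set.Ioi 0) := fun _ hx _ _ hxy =>
  Real.rpow_le_rpow_of_nonpos hx hxy (by linarith)

lemma hasDerivAt_rpow_neg_shift {r s c : ℝ} (h : 0 < s + c) :
    HasDerivAt (fun s : ℝ => (s + c) ^ (-r)) (-r * (s + c) ^ (-(r + 1))) s := by
  have := ((hasDerivAt_id s).add_const c).rpow_const (p := -r) (Or.inl h.ne')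
  simpa [neg_add, sub_eq_add_neg, add_comm] using this

lemma rpow_neg_first_diff_antitoneOn {r : ℝ} (hr : 0 < r) :
    AntitoneOn (fun s : ℝ => s ^ (-r) - (s + 1) ^ (-r)) (Set.Ioi 0) := by
  have hd : ∀ s ∈ Set.Ioi (0 : ℝ), HasDerivAt (fun s : ℝ => s ^ (-r) - (s + 1) ^ (-r))
      (-r * s ^ (-(r + 1)) - -r * (s + 1) ^ (-(r + 1))) s := by
    intro s hs
    rw [Set.mem_Ioi] at hs
    have h0 := hasDerivAt_rpow_neg_shift (r := r) (s := s) (c := 0) (by linarith)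
    simp only [add_zero] at h0
    exact h0.sub (hasDerivAt_rpow_neg_shift (by linarith))
  refine antitoneOn_of_deriv_nonpos (convex_Ioi 0)
    (fun s hs => (hd s hs).continuousAt.continuousWithinAt)
    (fun s hs => ((hd s (interior_subset hs)).differentiableAt).differentiableWithinAt) ?_
  intro s hs
  have hs' := interior_subset hs
  rw [(hd s hs').deriv]
  rw [Set.mem_Ioi] at hs'
  have := rpow_neg_antitoneOn (r := r + 1) (by linarith) hs'
    (show s + 1 ∈ Set.Ioi 0 from by rw [Set.mem_Ioi]; linarith) (by linarith)
  simp only at this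
  nlinarith

lemma rpow_neg_second_diff_antitoneOn {r : ℝ} (hr : 0 < r) :
    AntitoneOn (fun s : ℝ => s ^ (-r) - 2 * (s + 1) ^ (-r) + (s + 2) ^ (-r)) (Set.Ioi 0) := by
  have hd : ∀ s ∈ Set.Ioi (0 : ℝ),
      HasDerivAt (fun s : ℝ => s ^ (-r) - 2 * (s + 1) ^ (-r) + (s + 2) ^ (-r))
      (-r * s ^ (-(r + 1)) - 2 * (-r * (s + 1) ^ (-(r + 1))) + -r * (s + 2) ^ (-(r + 1))) s := by
    intro s hs
    rw [Set.mem_Ioi] at hs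
    have h0 := hasDerivAt_rpow_neg_shift (r := r) (s := s) (c := 0) (by linarith)
    simp only [add_zero] at h0
    exact (h0.sub ((hasDerivAt_rpow_neg_shift (by linarith)).const_mul 2)).add
      (hasDerivAt_rpow_neg_shift (by linarith))
  refine antitoneOn_of_deriv_nonpos (convex_Ioi 0)
    (fun s hs => (hd s hs).continuousAt.continuousWithinAt)
    (fun s hs => ((hd s (interior_subset hs)).differentiableAt).differentiableWithinAt) ?_
  intro s hs
  have hs' := interior_subset hs
  rw [(hd s hs').deriv]
  have := rpow_neg_second_diff_nonneg (r := r + 1) (by linarith) hs'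
  nlinarith

/-- First-moment bounds for a nonnegative nonincreasing function on a unit interval. -/
lemma moment_bounds {h : ℝ → ℝ} (hanti : AntitoneOn h (Set.Ioi 0))
    (hnonneg : ∀ s, 0 < s → 0 ≤ h s) (hcont : ContinuousOn h (Set.Ioi 0)) {k : ℝ} (hk : 1 ≤ k) :
    0 ≤ ∫ x in (-1 / 2 : ℝ)..(1 / 2), -x * h (k + x) ∧
      ∫ x in (-1 / 2 : ℝ)..(1 / 2), -x * h (k + x) ≤ ∫ x in (-1 / 2 : ℝ)..(1 / 2), h (k + x) := by
  have hle : (-1 / 2 : ℝ) ≤ 1 / 2 := by norm_num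
  have hc : ContinuousOn (fun x => h (k + x)) (Set.uIcc (-1 / 2 : ℝ) (1 / 2)) := by
    refine hcont.comp (by fun_prop) fun x hx => ?_
    rw [Set.uIcc_of_le hle] at hx
    rw [Set.mem_Ioi]; linarith [hx.1]
  have hc' : ContinuousOn (fun x => -x * h (k + x)) (Set.uIcc (-1 / 2 : ℝ) (1 / 2)) :=
    ContinuousOn.mul (by fun_prop) hc
  have h0 : ∫ x in (-1 / 2 : ℝ)..(1 / 2), -x * h k = 0 := by
    rw [intervalIntegral.integral_mul_const, intervalIntegral.integral_neg, integral_id]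
    norm_num
  constructor
  · rw [← h0]
    refine intervalIntegral.integral_mono_on hle
      (Continuous.intervalIntegrable (by fun_prop) _ _) hc'.intervalIntegrable fun x hx => ?_
    have hkx : k + x ∈ Set.Ioi (0 : ℝ) := by rw [Set.mem_Ioi]; linarith [hx.1]
    have hk0 : k ∈ Set.Ioi (0 : ℝ) := by rw [Set.mem_Ioi]; linarith
    rcases le_total 0 x with hx0 | hx0
    · nlinarith [hanti hk0 hkx (by linarith)]
    · nlinarith [hanti hkx hk0 (by linarith)]
  · refine intervalIntegral.integral_mono_on hle hc'.intervalIntegrable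
      hc.intervalIntegrable fun x hx => ?_
    nlinarith [hnonneg (k + x) (by linarith [hx.1]), hx.1, hx.2]

section Coefficients

variable {α : ℝ}

lemma continuousOn_shift_rpow (r k : ℝ) (hk : 1 ≤ k) :
    ContinuousOn (fun x : ℝ => (k + x) ^ r) (Set.uIcc (-1 / 2 : ℝ) (1 / 2)) := by
  refine ContinuousOn.rpow_const (by fun_prop) fun x hx => Or.inl ?_
  rw [Set.uIcc_of_le (by norm_num)] at hx
  linarith [hx.1]

lemma aC_eq_integral {k : ℕ} (hk : 1 ≤ k) :
    aC α k = (1 - α) * ∫ x in (-1 / 2 : ℝ)..(1 / 2), ((k : ℝ) + x) ^ (-α) := by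
  have hk' : (1 : ℝ) ≤ k := by exact_mod_cast hk
  have hd : ∀ x ∈ Set.uIcc (-1 / 2 : ℝ) (1 / 2),
      HasDerivAt (fun x : ℝ => ((k : ℝ) + x) ^ (1 - α)) ((1 - α) * ((k : ℝ) + x) ^ (-α)) x := by
    intro x hx
    rw [Set.uIcc_of_le (by norm_num)] at hx
    have := ((hasDerivAt_id x).const_add (k : ℝ)).rpow_const (p := 1 - α)
      (Or.inl (by simp only [id]; linarith [hx.1]))
    simpa using this
  rw [← intervalIntegral.integral_const_mul,
    intervalIntegral.integral_eq_sub_of_hasDerivAt hd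
      ((continuousOn_shift_rpow _ _ hk').const_mul _).intervalIntegrable, aC, if_neg (by omega)]
  congr 2
  ring

lemma bC_eq_integral (hα : α < 1) {k : ℕ} (hk : 1 ≤ k) :
    bC α k = (1 - α) * ∫ x in (-1 / 2 : ℝ)..(1 / 2), -x * ((k : ℝ) + x) ^ (-α) := by
  have hk' : (1 : ℝ) ≤ k := by exact_mod_cast hk
  have hd : ∀ x ∈ Set.uIcc (-1 / 2 : ℝ) (1 / 2),
      HasDerivAt (fun x : ℝ => 1 / (2 - α) * ((k : ℝ) + x) ^ (2 - α) - x * ((k : ℝ) + x) ^ (1 - α))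
        ((1 - α) * (-x * ((k : ℝ) + x) ^ (-α))) x := by
    intro x hx
    rw [Set.uIcc_of_le (by norm_num)] at hx
    have hne : (k : ℝ) + x ≠ 0 := by linarith [hx.1]
    have h1 := ((hasDerivAt_id x).const_add (k : ℝ)).rpow_const (p := 1 - α) (Or.inl hne)
    have h2 := ((hasDerivAt_id x).const_add (k : ℝ)).rpow_const (p := 2 - α) (Or.inl hne)
    have h3 := (h2.const_mul (1 / (2 - α))).sub ((hasDerivAt_id x).mul h1)
    refine h3.congr_deriv ?_
    simp only [id, one_mul]
    rw [show 2 - α - 1 = 1 - α by ring, show 1 - α - 1 = -α by ring]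
    have : 2 - α ≠ 0 := by linarith
    field_simp
    ring
  rw [← intervalIntegral.integral_const_mul,
    intervalIntegral.integral_eq_sub_of_hasDerivAt hd
      ((ContinuousOn.mul (by fun_prop)
        (continuousOn_shift_rpow _ _ hk')).const_mul _).intervalIntegrable, bC,
    show (k : ℝ) + -1 / 2 = k - 1 / 2 by ring]
  ring

lemma bC_bounds (h0 : 0 < α) (h1 : α < 1) {k : ℕ} (hk : 1 ≤ k) :
    0 ≤ bC α k ∧ bC α k ≤ aC α k := by
  have hk' : (1 : ℝ) ≤ k := by exact_mod_cast hk
  have hcont : ContinuousOn (fun s : ℝ => s ^ (-α)) (Set.Ioi 0) :=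
    ContinuousOn.rpow_const continuousOn_id fun x hx => Or.inl (ne_of_gt hx)
  obtain ⟨hl, hu⟩ := moment_bounds (rpow_neg_antitoneOn h0)
    (fun s hs => (Real.rpow_pos_of_pos hs _).le) hcont hk'
  rw [aC_eq_integral hk, bC_eq_integral h1 hk]
  exact ⟨mul_nonneg (by linarith) hl, mul_le_mul_of_nonneg_left hu (by linarith)⟩

lemma bC_first_diff_bounds (h0 : 0 < α) (h1 : α < 1) {k : ℕ} (hk : 1 ≤ k) :
    0 ≤ bC α k - bC α (k + 1) ∧ bC α k - bC α (k + 1) ≤ aC α k - aC α (k + 1) := by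
  have hk' : (1 : ℝ) ≤ k := by exact_mod_cast hk
  have hcont : ContinuousOn (fun s : ℝ => s ^ (-α) - (s + 1) ^ (-α)) (Set.Ioi 0) := by
    refine ContinuousOn.sub ?_ ?_ <;>
    exact ContinuousOn.rpow_const (by fun_prop) fun x hx => Or.inl (by
      rw [Set.mem_Ioi] at hx; linarith)
  obtain ⟨hl, hu⟩ := moment_bounds (rpow_neg_first_diff_antitoneOn h0)
    (fun s hs => sub_nonneg.2 (Real.rpow_le_rpow_of_nonpos hs (by linarith) (by linarith)))
    hcont hk'
  have hA : ∀ m : ℝ, 1 ≤ m → IntervalIntegrable (fun x : ℝ => (m + x) ^ (-α))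
      MeasureTheory.volume (-1 / 2) (1 / 2) :=
    fun m hm => (continuousOn_shift_rpow _ _ hm).intervalIntegrable
  have hB : ∀ m : ℝ, 1 ≤ m → IntervalIntegrable (fun x : ℝ => -x * (m + x) ^ (-α))
      MeasureTheory.volume (-1 / 2) (1 / 2) :=
    fun m hm => (ContinuousOn.mul (by fun_prop) (continuousOn_shift_rpow _ _ hm)).intervalIntegrable
  have ea : aC α k - aC α (k + 1) = (1 - α) * ∫ x in (-1 / 2 : ℝ)..(1 / 2),
      (((k : ℝ) + x) ^ (-α) - ((k : ℝ) + x + 1) ^ (-α)) := by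
    rw [aC_eq_integral hk, aC_eq_integral (by omega : 1 ≤ k + 1), ← mul_sub,
      ← intervalIntegral.integral_sub (hA _ hk') (hA _ (by push_cast; linarith))]
    simp only [Nat.cast_add, Nat.cast_one, add_right_comm]
  have eb : bC α k - bC α (k + 1) = (1 - α) * ∫ x in (-1 / 2 : ℝ)..(1 / 2),
      -x * (((k : ℝ) + x) ^ (-α) - ((k : ℝ) + x + 1) ^ (-α)) := by
    rw [bC_eq_integral h1 hk, bC_eq_integral h1 (by omega : 1 ≤ k + 1), ← mul_sub,
      ← intervalIntegral.integral_sub (hB _ hk') (hB _ (by push_cast; linarith))]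
    simp only [Nat.cast_add, Nat.cast_one, add_right_comm, mul_sub]
  rw [ea, eb]
  exact ⟨mul_nonneg (by linarith) hl, mul_le_mul_of_nonneg_left hu (by linarith)⟩

lemma bC_second_diff_bounds (h0 : 0 < α) (h1 : α < 1) {k : ℕ} (hk : 1 ≤ k) :
    0 ≤ bC α k - 2 * bC α (k + 1) + bC α (k + 2) ∧
      bC α k - 2 * bC α (k + 1) + bC α (k + 2)
        ≤ aC α k - 2 * aC α (k + 1) + aC α (k + 2) := by
  have hk' : (1 : ℝ) ≤ k := by exact_mod_cast hk
  have hcont : ContinuousOn (fun s : ℝ => s ^ (-α) - 2 * (s + 1) ^ (-α) + (s + 2) ^ (-α))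
      (Set.Ioi 0) := by
    refine ContinuousOn.add (ContinuousOn.sub ?_ (ContinuousOn.mul (by fun_prop) ?_)) ?_ <;>
    exact ContinuousOn.rpow_const (by fun_prop) fun x hx => Or.inl (by
      rw [Set.mem_Ioi] at hx; linarith)
  obtain ⟨hl, hu⟩ := moment_bounds (rpow_neg_second_diff_antitoneOn h0)
    (fun s hs => rpow_neg_second_diff_nonneg h0 hs) hcont hk'
  have hA : ∀ m : ℝ, 1 ≤ m → IntervalIntegrable (fun x : ℝ => (m + x) ^ (-α))
      MeasureTheory.volume (-1 / 2) (1 / 2) :=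
    fun m hm => (continuousOn_shift_rpow _ _ hm).intervalIntegrable
  have hB : ∀ m : ℝ, 1 ≤ m → IntervalIntegrable (fun x : ℝ => -x * (m + x) ^ (-α))
      MeasureTheory.volume (-1 / 2) (1 / 2) :=
    fun m hm => (ContinuousOn.mul (by fun_prop) (continuousOn_shift_rpow _ _ hm)).intervalIntegrable
  have ea : aC α k - 2 * aC α (k + 1) + aC α (k + 2) = (1 - α) * ∫ x in (-1 / 2 : ℝ)..(1 / 2),
      (((k : ℝ) + x) ^ (-α) - 2 * ((k : ℝ) + x + 1) ^ (-α) + ((k : ℝ) + x + 2) ^ (-α)) := by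
    rw [aC_eq_integral hk, aC_eq_integral (by omega : 1 ≤ k + 1),
      aC_eq_integral (by omega : 1 ≤ k + 2)]
    simp only [Nat.cast_add, Nat.cast_one, Nat.cast_ofNat, add_right_comm (k : ℝ) _ (_ : ℝ)]
    have i0 := hA k hk'
    have i1 := hA (k + 1) (by linarith)
    have i2 := hA (k + 2) (by linarith)
    simp only [add_right_comm (k : ℝ) 1, add_right_comm (k : ℝ) 2] at i1 i2 ⊢
    rw [intervalIntegral.integral_add (i0.sub (i1.const_mul 2)) i2,
      intervalIntegral.integral_sub i0 (i1.const_mul 2), intervalIntegral.integral_const_mul]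
    ring
  have eb : bC α k - 2 * bC α (k + 1) + bC α (k + 2) = (1 - α) * ∫ x in (-1 / 2 : ℝ)..(1 / 2),
      -x * (((k : ℝ) + x) ^ (-α) - 2 * ((k : ℝ) + x + 1) ^ (-α) + ((k : ℝ) + x + 2) ^ (-α)) := by
    rw [bC_eq_integral h1 hk, bC_eq_integral h1 (by omega : 1 ≤ k + 1),
      bC_eq_integral h1 (by omega : 1 ≤ k + 2)]
    simp only [Nat.cast_add, Nat.cast_one, Nat.cast_ofNat]
    have i0 := hB k hk'
    have i1 := hB (k + 1) (by linarith)
    have i2 := hB (k + 2) (by linarith)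
    simp only [add_right_comm (k : ℝ) 1, add_right_comm (k : ℝ) 2] at i1 i2 ⊢
    simp only [mul_add, mul_sub, mul_left_comm _ (2 : ℝ)]
    rw [intervalIntegral.integral_add (i0.sub (i1.const_mul 2)) i2,
      intervalIntegral.integral_sub i0 (i1.const_mul 2), intervalIntegral.integral_const_mul]
    ring
  rw [ea, eb]
  exact ⟨mul_nonneg (by linarith) hl, mul_le_mul_of_nonneg_left hu (by linarith)⟩

lemma aC_zero_ge (h0 : 0 < α) (h1 : α < 1) : aC α 1 ≤ 2 * aC α 0 ∧
    0 ≤ 2 * aC α 0 - 2 * aC α 1 + aC α 2 := by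
  have hh : (0 : ℝ) < (1 / 2 : ℝ) ^ (1 - α) := by positivity
  have e3 : (3 / 2 : ℝ) ^ (1 - α) = 3 ^ (1 - α) * (1 / 2) ^ (1 - α) := by
    rw [← Real.mul_rpow (by norm_num) (by norm_num)]; norm_num
  have e5 : (5 / 2 : ℝ) ^ (1 - α) = 5 ^ (1 - α) * (1 / 2) ^ (1 - α) := by
    rw [← Real.mul_rpow (by norm_num) (by norm_num)]; norm_num
  have a0 : aC α 0 = (1 / 2) ^ (1 - α) := by simp [aC]
  have a1 : aC α 1 = 3 ^ (1 - α) * (1 / 2) ^ (1 - α) - (1 / 2) ^ (1 - α) := by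
    rw [← e3]; norm_num [aC]
  have a2 : aC α 2 = 5 ^ (1 - α) * (1 / 2) ^ (1 - α) - 3 ^ (1 - α) * (1 / 2) ^ (1 - α) := by
    rw [← e3, ← e5]; norm_num [aC]
  have u3 : (3 : ℝ) ^ (1 - α) = 3 * 3 ^ (-α) := by
    rw [sub_eq_add_neg, Real.rpow_add (by norm_num), Real.rpow_one]
  have u5 : (5 : ℝ) ^ (1 - α) = 5 * 5 ^ (-α) := by
    rw [sub_eq_add_neg, Real.rpow_add (by norm_num), Real.rpow_one]
  have hu : (3 : ℝ) ^ (-α) ≤ 1 :=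
    Real.rpow_le_one_of_one_le_of_nonpos (by norm_num) (by linarith)
  have hu0 : (0 : ℝ) < 3 ^ (-α) := by positivity
  have hv0 : (0 : ℝ) < 5 ^ (-α) := by positivity
  -- `5 ^ 2 ≤ 3 ^ 3` turns into a comparison of the two negative powers
  have h53 : ((3 : ℝ) ^ (-α)) ^ 3 ≤ ((5 : ℝ) ^ (-α)) ^ 2 := by
    rw [← Real.rpow_natCast, ← Real.rpow_mul (by norm_num), ← Real.rpow_natCast ((5 : ℝ) ^ (-α)),
      ← Real.rpow_mul (by norm_num), mul_comm, Real.rpow_mul (by norm_num), mul_comm (-α),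
      Real.rpow_mul (by norm_num)]
    exact Real.rpow_le_rpow_of_nonpos (by positivity) (by norm_num) (by linarith)
  have hv : (3 * 3 ^ (-α) - 1) / 2 ≤ (5 : ℝ) ^ (-α) := by
    by_contra! hlt
    have hw : ((3 * (3 : ℝ) ^ (-α) - 1) / 2) ^ 2 ≤ ((3 : ℝ) ^ (-α)) ^ 3 := by
      nlinarith [mul_nonneg (sq_nonneg ((3 : ℝ) ^ (-α) - 1))
        (show (0 : ℝ) ≤ 4 * 3 ^ (-α) - 1 by linarith)]
    nlinarith
  rw [a0, a1, a2, u3, u5]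
  constructor <;> nlinarith

/-- The level-`n` kernel is a fixed kernel, corrected only in its oldest entry. -/
lemma cC_eq (n k : ℕ) (hk : k < n) :
    cC α n k = aC α k + bC α (k + 1) - (if k = 0 then 0 else bC α k)
      - (if k + 1 = n then bC α n else 0) := by
  unfold cC
  by_cases hn : n ≤ 1
  · obtain rfl : n = 1 := by omega
    obtain rfl : k = 0 := by omega
    simp
  · rw [if_neg hn]
    by_cases h0 : k = 0
    · subst h0
      simp [show ¬ 1 = n by omega]
    · rw [if_neg h0, if_neg h0]
      by_cases h1 : k = n - 1
      · subst h1
        rw [if_pos rfl, if_pos (by omega), show n - 1 + 1 = n by omega]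
        ring
      · rw [if_neg h1, if_neg (by omega), sub_zero]

/-- The quadratic form of the kernels `cC` is nonnegative. -/
lemma sum_cC_nonneg (h0 : 0 < α) (h1 : α < 1) (v : ℕ → ℝ) (N : ℕ) :
    0 ≤ ∑ n ∈ Finset.Icc 1 N, v n * ∑ k ∈ Finset.Icc 1 n, cC α n (n - k) * v k := by
  have hB : ∀ k, 0 ≤ bC α (k + 1) ∧ bC α (k + 1) ≤ aC α (k + 1) :=
    fun k => bC_bounds h0 h1 (by omega)
  have hB1 : ∀ k, 0 ≤ bC α (k + 1) - bC α (k + 2) ∧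
      bC α (k + 1) - bC α (k + 2) ≤ aC α (k + 1) - aC α (k + 2) :=
    fun k => bC_first_diff_bounds h0 h1 (by omega)
  have hB2 : ∀ k, 0 ≤ bC α (k + 1) - 2 * bC α (k + 2) + bC α (k + 3) ∧
      bC α (k + 1) - 2 * bC α (k + 2) + bC α (k + 3)
        ≤ aC α (k + 1) - 2 * aC α (k + 2) + aC α (k + 3) :=
    fun k => bC_second_diff_bounds h0 h1 (by omega)
  obtain ⟨ha1, ha2⟩ := aC_zero_ge h0 h1
  let C : ℕ → ℕ → ℝ := fun k n => if k = 0 then 0 else cC α n (n - k)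
  let T : ℕ → ℕ → ℝ := fun k n => if k = n then 2 * C k n else C k n
  have hC0 : ∀ n, C 0 n = 0 := fun n => if_pos rfl
  have hTlt : ∀ k n, k < n → T k n = C k n := fun k n hk => if_neg hk.ne
  have hTd : ∀ n, T n n = 2 * C n n := fun n => if_pos rfl
  -- entries of `C`, indexed by row `k` and lag `m`
  have hdiag1 : C 1 1 = aC α 0 := by simp [C, cC]
  have hdiag : ∀ k, C (k + 2) (k + 2) = aC α 0 + bC α 1 := by
    intro k
    simp only [C, if_neg (show ¬ k + 2 = 0 by omega), Nat.sub_self]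
    rw [cC_eq _ _ (by omega)]
    simp
  have hfirst : ∀ m, C 1 (m + 2) = aC α (m + 1) - bC α (m + 1) := by
    intro m
    simp only [C, if_neg (show ¬ 1 = 0 by omega)]
    rw [cC_eq _ _ (by omega), show m + 2 - 1 = m + 1 by omega]
    simp
    ring
  have hgen : ∀ k m, C (k + 2) (k + 2 + (m + 1))
      = aC α (m + 1) + bC α (m + 2) - bC α (m + 1) := by
    intro k m
    simp only [C, if_neg (show ¬ k + 2 = 0 by omega)]
    rw [cC_eq _ _ (by omega), show k + 2 + (m + 1) - (k + 2) = m + 1 by omega,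
      if_neg (by omega), if_neg (by omega), sub_zero]
  have hres := sum_mul_sum_nonneg_of_mixed_diff C T v hC0 hTlt hTd ?_ ?_ N
  · refine hres.trans_eq (Finset.sum_congr rfl fun n _ => ?_)
    congr 1
    refine Finset.sum_congr rfl fun k hk => ?_
    rw [Finset.mem_Icc] at hk
    simp only [C, if_neg (show ¬ k = 0 by omega)]
  · intro k n hk hkn
    obtain ⟨m, rfl⟩ : ∃ m, n = k + m := ⟨n - k, by omega⟩
    rw [hTlt (k - 1) _ (by omega)]
    obtain rfl | rfl | ⟨k, rfl⟩ : k = 1 ∨ k = 2 ∨ ∃ j, k = j + 3 := by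
      by_cases h : k ≤ 2
      · omega
      · exact Or.inr (Or.inr ⟨k - 3, by omega⟩)
    · rw [hC0]
      rcases m with _ | m
      · rw [hTd, hdiag1]
        linarith [hB 0, hB1 0]
      · rw [hTlt _ _ (by omega), show 1 + (m + 1) = m + 2 by omega, hfirst]
        linarith [hB m]
    · rcases m with _ | m
      · rw [hTd, hdiag, hfirst 0]
        linarith [hB 0]
      · rw [hTlt _ _ (by omega), hgen 0 m, show 2 + (m + 1) = (m + 1) + 2 by omega, hfirst]
        linarith [hB m, hB (m + 1), hB1 m]
    · rcases m with _ | m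
      · rw [hTd, hdiag, show k + 3 - 1 = k + 2 by omega, hgen k 0]
        linarith [hB 0, hB1 0]
      · rw [hTlt _ _ (by omega), hgen (k + 1) m, show k + 3 - 1 = k + 2 by omega,
          show k + 3 + (m + 1) = k + 2 + (m + 1 + 1) by omega, hgen k (m + 1)]
        linarith [hB1 m, hB2 m, hB (m + 1), hB1 (m + 1)]
  · intro k n hk hkn
    obtain ⟨m, rfl⟩ : ∃ m, n = k + m := ⟨n - k, by omega⟩
    rw [hTlt (k - 1) _ (by omega), hTlt (k - 1) _ (by omega), hTlt k (k + m + 1) (by omega)]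
    obtain rfl | rfl | ⟨k, rfl⟩ : k = 1 ∨ k = 2 ∨ ∃ j, k = j + 3 := by
      by_cases h : k ≤ 2
      · omega
      · exact Or.inr (Or.inr ⟨k - 3, by omega⟩)
    · simp only [Nat.sub_self, hC0]
      rcases m with _ | m
      · rw [hTd, hdiag1, hfirst 0]
        linarith [hB 0]
      · rw [hTlt _ _ (by omega), show 1 + (m + 1) = m + 2 by omega, hfirst, hfirst]
        linarith [hB1 m]
    · rcases m with _ | m
      · rw [hTd, hdiag, hfirst 0, hgen 0 0, hfirst 1]
        linarith [hB 0, hB1 0, hB1 1, hB 1, hB 2]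
      · rw [hTlt _ _ (by omega), hgen 0 m, show 2 + (m + 1) + 1 = 2 + (m + 1 + 1) by omega,
          hgen 0 (m + 1), show 2 + (m + 1) = (m + 1) + 2 by omega, hfirst,
          show 2 + (m + 1 + 1) = (m + 2) + 2 by omega, hfirst]
        linarith [hB2 m, hB1 (m + 1), hB1 m, hB2 (m + 1), hB1 (m + 2)]
    · simp only [show k + 3 - 1 = k + 2 by omega]
      rcases m with _ | m
      · rw [hTd, hdiag, hgen k 0, hgen (k + 1) 0, hgen k 1]
        linarith [hB 0, hB1 0, hB1 1, hB 1, hB 2]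
      · rw [hTlt _ _ (by omega), hgen (k + 1) m,
          show k + 3 + (m + 1) + 1 = k + 3 + (m + 1 + 1) by omega, hgen (k + 1) (m + 1),
          show k + 3 + (m + 1) = k + 2 + (m + 1 + 1) by omega, hgen k (m + 1),
          show k + 3 + (m + 1 + 1) = k + 2 + (m + 2 + 1) by omega, hgen k (m + 2)]
        linarith [hB2 m, hB2 (m + 1), hB1 (m + 2), hB1 (m + 1)]

end Coefficients

lemma aG_succ_le {γ : ℝ} (h1 : 1 < γ) (h2 : γ < 2) (k : ℕ) : aG γ (k + 1) ≤ aG γ k := by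
  have h := (Real.concaveOn_rpow (p := 2 - γ) (by linarith) (by linarith)).2
    (Set.mem_Ici.2 k.cast_nonneg) (show (k : ℝ) + 2 ∈ Set.Ici 0 from by
      rw [Set.mem_Ici]; positivity)
    (show (0 : ℝ) ≤ 1 / 2 by norm_num) (show (0 : ℝ) ≤ 1 / 2 by norm_num) (by norm_num)
  simp only [smul_eq_mul] at h
  rw [show 1 / 2 * (k : ℝ) + 1 / 2 * (k + 2) = k + 1 by ring] at h
  unfold aG
  push_cast
  rw [show (k : ℝ) + 1 + 1 = k + 2 by ring]
  linarith

lemma le_aG {γ : ℝ} (h1 : 1 < γ) (h2 : γ < 2) (k : ℕ) :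
    (2 - γ) * ((k : ℝ) + 1) ^ (1 - γ) ≤ aG γ k := by
  have hk : (0 : ℝ) < k + 1 := by positivity
  have hb := rpow_one_add_le_one_add_mul_self (s := -(1 / ((k : ℝ) + 1))) (p := 2 - γ)
    (by rw [neg_le_neg_iff, div_le_one hk]; linarith [k.cast_nonneg (α := ℝ)])
    (by linarith) (by linarith)
  have he : (k : ℝ) = (k + 1) * (1 + -(1 / ((k : ℝ) + 1))) := by field_simp; ring
  have hnn : 0 ≤ 1 + -(1 / ((k : ℝ) + 1)) := by
    rw [← sub_eq_add_neg, sub_nonneg, div_le_one hk]; linarith [k.cast_nonneg (α := ℝ)]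
  have hp : ((k : ℝ) + 1) ^ (2 - γ) = (k + 1) ^ (1 - γ) * (k + 1) := by
    rw [← Real.rpow_add_one hk.ne']; congr 1; ring
  have hk2 : (k : ℝ) ^ (2 - γ)
      = (k + 1) ^ (2 - γ) * (1 + -(1 / ((k : ℝ) + 1))) ^ (2 - γ) := by
    rw [← Real.mul_rpow hk.le hnn, ← he]
  have h3 := mul_le_mul_of_nonneg_left hb (Real.rpow_nonneg hk.le (2 - γ))
  have h4 : ((k : ℝ) + 1) ^ (2 - γ) * (1 + (2 - γ) * -(1 / ((k : ℝ) + 1)))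
      = (k + 1) ^ (2 - γ) - (2 - γ) * (k + 1) ^ (1 - γ) := by
    rw [hp]; field_simp; ring
  unfold aG
  linarith

lemma sum_aG {γ : ℝ} (h2 : γ < 2) (N : ℕ) :
    ∑ n ∈ Finset.Icc 1 N, aG γ (n - 1) = (N : ℝ) ^ (2 - γ) := by
  induction N with
  | zero => simp [Real.zero_rpow (show 2 - γ ≠ 0 by linarith)]
  | succ n ih =>
    rw [Finset.sum_Icc_succ_top (by omega), ih, Nat.add_sub_cancel, aG]
    push_cast
    ring

/-- Energy bound for the weighted L1 term of order `γ`. -/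
lemma weighted_aG_energy {γ T τ A φ : ℝ} {N : ℕ} (h1 : 1 < γ) (h2 : γ < 2) (hA : 0 < A)
    (hT : 0 < T) (hN : 1 ≤ N) (hτ : τ = T / N) (v : ℕ → ℝ) :
    τ * (A * T ^ (1 - γ) / Real.Gamma (2 - γ)) * ∑ n ∈ Finset.Icc 1 N, v n ^ 2
        - A * T ^ (2 - γ) / Real.Gamma (3 - γ) * φ ^ 2
      ≤ ∑ n ∈ Finset.Icc 1 N, 2 * τ * v n * (A * (τ ^ (1 - γ) / Real.Gamma (3 - γ)) *
          (aG γ 0 * v n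
            - (∑ k ∈ Finset.Icc 1 (n - 1), (aG γ (n - k - 1) - aG γ (n - k)) * v k)
            - aG γ (n - 1) * φ)) := by
  have hNpos : (0 : ℝ) < N := by exact_mod_cast hN
  have hτpos : 0 < τ := by rw [hτ]; positivity
  have hTτ : T = τ * N := by rw [hτ]; field_simp
  have hG2 : 0 < Real.Gamma (2 - γ) := Real.Gamma_pos_of_pos (by linarith)
  have hG3 : Real.Gamma (3 - γ) = (2 - γ) * Real.Gamma (2 - γ) := by
    rw [← Real.Gamma_add_one (by linarith)]; congr 1; ring
  have h2γ : 0 < 2 - γ := by linarith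
  have hpow1 : T ^ (1 - γ) = τ ^ (1 - γ) * (N : ℝ) ^ (1 - γ) := by
    rw [hTτ, Real.mul_rpow hτpos.le hNpos.le]
  have hpow2 : T ^ (2 - γ) = τ * τ ^ (1 - γ) * (N : ℝ) ^ (2 - γ) := by
    rw [hTτ, Real.mul_rpow hτpos.le hNpos.le, mul_comm τ, ← Real.rpow_add_one hτpos.ne']
    congr 2; ring
  have hpos : ∀ k, 0 ≤ aG γ k := fun k => le_trans (by positivity) (le_aG h1 h2 k)
  have hconv := sum_sq_le_sum_convolution (aG γ) v φ (aG_succ_le h1 h2) hpos N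
  rw [sum_aG h2] at hconv
  have hlow : (2 - γ) * (N : ℝ) ^ (1 - γ) * ∑ n ∈ Finset.Icc 1 N, v n ^ 2
      ≤ ∑ k ∈ Finset.Icc 1 N, aG γ (N - k) * v k ^ 2 := by
    rw [Finset.mul_sum]
    refine Finset.sum_le_sum fun k hk => mul_le_mul_of_nonneg_right ?_ (sq_nonneg _)
    rw [Finset.mem_Icc] at hk
    refine le_trans (mul_le_mul_of_nonneg_left ?_ h2γ.le) (le_aG h1 h2 _)
    refine Real.rpow_le_rpow_of_nonpos (by positivity) ?_ (by linarith)
    have : N - k + 1 ≤ N := by omega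
    exact_mod_cast this
  have hscale : 0 ≤ τ * (A * (τ ^ (1 - γ) / Real.Gamma (3 - γ))) := by
    rw [hG3]; positivity
  have h := mul_le_mul_of_nonneg_left ((sub_le_sub_right hlow _).trans hconv) hscale
  refine (le_of_eq ?_).trans (h.trans_eq ?_)
  · rw [hpow1, hpow2, hG3]
    field_simp
  · rw [Finset.mul_sum]
    exact Finset.sum_congr rfl fun n _ => by ring

/-- Energy inequality for the time-stepping equation at a single grid point; `R` collects the
spatial terms. -/
lemma pointwise_energy {T τ b1 b2 φ : ℝ} {N p q : ℕ} (hT : 0 < T) (hN : 1 ≤ N) (hτ : τ = T / N)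
    (hb1 : 0 < b1) {a γ c α : ℕ → ℝ}
    (haγ : ∀ l ∈ Finset.Icc 1 p, 0 < a l ∧ 1 < γ l ∧ γ l < 2)
    (hcα : ∀ m ∈ Finset.Icc 1 q, 0 < c m ∧ 0 < α m ∧ α m < 1)
    {u v R f : ℕ → ℝ} (hv : ∀ n, v n = (u n - u (n - 1)) / τ)
    (heq : ∀ n ∈ Finset.Icc 1 N,
      (∑ l ∈ Finset.Icc 1 p, a l * (τ ^ (1 - γ l) / Real.Gamma (3 - γ l)) *
          (aG (γ l) 0 * v n
            - (∑ k ∈ Finset.Icc 1 (n - 1), (aG (γ l) (n - k - 1) - aG (γ l) (n - k)) * v k)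
            - aG (γ l) (n - 1) * φ))
        + b1 * v n
        + (∑ m ∈ Finset.Icc 1 q, c m * (τ ^ (1 - α m) / Real.Gamma (2 - α m)) *
            ∑ k ∈ Finset.Icc 1 n, cC (α m) n (n - k) * v k)
        + b2 * ((u n + u (n - 1)) / 2) = R n + f n) :
    b2 * (u N ^ 2 - u 0 ^ 2)
      ≤ (∑ l ∈ Finset.Icc 1 p, a l * T ^ (2 - γ l) / Real.Gamma (3 - γ l)) * φ ^ 2
        + τ / ((∑ l ∈ Finset.Icc 1 p, a l * T ^ (1 - γ l) / Real.Gamma (2 - γ l)) + 2 * b1)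
          * ∑ n ∈ Finset.Icc 1 N, f n ^ 2
        + ∑ n ∈ Finset.Icc 1 N, 2 * τ * v n * R n := by
  have hNpos : (0 : ℝ) < N := by exact_mod_cast hN
  have hτpos : 0 < τ := by rw [hτ]; positivity
  set κ := ∑ l ∈ Finset.Icc 1 p, a l * T ^ (1 - γ l) / Real.Gamma (2 - γ l) with hκ
  have hκ0 : 0 ≤ κ := Finset.sum_nonneg fun l hl => by
    obtain ⟨ha, hγ1, hγ2⟩ := haγ l hl
    have := Real.Gamma_pos_of_pos (show 0 < 2 - γ l by linarith)
    positivity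
  have hK : 0 < κ + 2 * b1 := by linarith
  set X : ℕ → ℕ → ℝ := fun l n => a l * (τ ^ (1 - γ l) / Real.Gamma (3 - γ l)) *
    (aG (γ l) 0 * v n
      - (∑ k ∈ Finset.Icc 1 (n - 1), (aG (γ l) (n - k - 1) - aG (γ l) (n - k)) * v k)
      - aG (γ l) (n - 1) * φ) with hX
  set Y : ℕ → ℕ → ℝ := fun m n => c m * (τ ^ (1 - α m) / Real.Gamma (2 - α m)) *
    ∑ k ∈ Finset.Icc 1 n, cC (α m) n (n - k) * v k with hY
  have hXsum : τ * κ * ∑ n ∈ Finset.Icc 1 N, v n ^ 2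
        - (∑ l ∈ Finset.Icc 1 p, a l * T ^ (2 - γ l) / Real.Gamma (3 - γ l)) * φ ^ 2
      ≤ ∑ n ∈ Finset.Icc 1 N, 2 * τ * v n * ∑ l ∈ Finset.Icc 1 p, X l n := by
    simp only [Finset.mul_sum (Finset.Icc 1 p)]
    rw [Finset.sum_comm, hκ, Finset.mul_sum (Finset.Icc 1 p), Finset.sum_mul, Finset.sum_mul,
      ← Finset.sum_sub_distrib]
    refine Finset.sum_le_sum fun l hl => ?_
    obtain ⟨ha, hγ1, hγ2⟩ := haγ l hl
    exact weighted_aG_energy hγ1 hγ2 ha hT hN hτ v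
  have hYsum : 0 ≤ ∑ n ∈ Finset.Icc 1 N, 2 * τ * v n * ∑ m ∈ Finset.Icc 1 q, Y m n := by
    simp only [Finset.mul_sum (Finset.Icc 1 q)]
    rw [Finset.sum_comm]
    refine Finset.sum_nonneg fun m hm => ?_
    obtain ⟨hc, hα1, hα2⟩ := hcα m hm
    have hG := Real.Gamma_pos_of_pos (show 0 < 2 - α m by linarith)
    have h := mul_nonneg (show 0 ≤ 2 * τ * (c m * (τ ^ (1 - α m) / Real.Gamma (2 - α m))) by
      positivity) (sum_cC_nonneg hα1 hα2 v N)
    rw [Finset.mul_sum] at h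
    refine h.trans_eq (Finset.sum_congr rfl fun n _ => ?_)
    simp only [hY]
    ring
  have hstep : ∑ n ∈ Finset.Icc 1 N, (2 * τ * v n * (∑ l ∈ Finset.Icc 1 p, X l n)
        + 2 * τ * v n * (∑ m ∈ Finset.Icc 1 q, Y m n) + b2 * (u n ^ 2 - u (n - 1) ^ 2))
      ≤ ∑ n ∈ Finset.Icc 1 N, (τ * κ * v n ^ 2 + τ / (κ + 2 * b1) * f n ^ 2
        + 2 * τ * v n * R n) := by
    refine Finset.sum_le_sum fun n hn => ?_
    have hu : b2 * (u n ^ 2 - u (n - 1) ^ 2)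
        = 2 * τ * v n * (b2 * ((u n + u (n - 1)) / 2)) := by
      rw [hv]; field_simp; ring
    have hyoung : 2 * v n * f n ≤ (κ + 2 * b1) * v n ^ 2 + f n ^ 2 / (κ + 2 * b1) := by
      have : 0 ≤ ((κ + 2 * b1) * v n - f n) ^ 2 / (κ + 2 * b1) := by positivity
      have e : ((κ + 2 * b1) * v n - f n) ^ 2 / (κ + 2 * b1)
          = (κ + 2 * b1) * v n ^ 2 - 2 * v n * f n + f n ^ 2 / (κ + 2 * b1) := by
        field_simp; ring
      linarith
    have hyoung' := mul_le_mul_of_nonneg_left hyoung hτpos.le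
    have e1 : τ * (f n ^ 2 / (κ + 2 * b1)) = τ / (κ + 2 * b1) * f n ^ 2 := by ring
    have e2 := congrArg (fun z => 2 * τ * v n * z) (heq n hn)
    linear_combination hyoung' + e2 + hu + e1
  simp only [Finset.sum_add_distrib] at hstep
  rw [← Finset.mul_sum, sum_Icc_one_sub_pred (fun n => u n ^ 2), ← Finset.mul_sum,
    ← Finset.mul_sum] at hstep
  linarith

/-- The memory part of the diffusion is dissipative. -/
lemma sum_cC_dirichletForm_nonneg {β : ℝ} (h0 : 0 < β) (h1 : β < 1) (hx hy : ℝ) (Mx My N : ℕ)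
    (V : ℕ → ℕ → ℕ → ℝ) :
    0 ≤ ∑ n ∈ Finset.Icc 1 N, ∑ k ∈ Finset.Icc 1 n,
      cC β n (n - k) * dirichletForm hx hy Mx My (V k) (V n) := by
  have edge : ∀ (s : Finset (ℕ × ℕ)) (x : ℕ → ℕ × ℕ → ℝ),
      0 ≤ ∑ n ∈ Finset.Icc 1 N, ∑ k ∈ Finset.Icc 1 n,
        cC β n (n - k) * ∑ e ∈ s, x k e * x n e := by
    intro s x
    refine (Finset.sum_nonneg fun e _ => sum_cC_nonneg h0 h1 (fun n => x n e) N
      : (0 : ℝ) ≤ ∑ e ∈ s, _).trans_eq ?_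
    rw [Finset.sum_comm]
    refine Finset.sum_congr rfl fun n _ => ?_
    simp only [Finset.mul_sum]
    rw [Finset.sum_comm]
    exact Finset.sum_congr rfl fun k _ => Finset.sum_congr rfl fun e _ => by ring
  have hX := edge (Finset.Icc 1 Mx ×ˢ Finset.Icc 1 (My - 1))
    (fun n e => (V n e.1 e.2 - V n (e.1 - 1) e.2) / hx)
  have hY := edge (Finset.Icc 1 (Mx - 1) ×ˢ Finset.Icc 1 My)
    (fun n e => (V n e.1 e.2 - V n e.1 (e.2 - 1)) / hy)
  simp only [Finset.sum_product] at hX hY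
  simp only [dirichletForm, mul_add, Finset.sum_add_distrib]
  exact add_nonneg hX hY

/-- Energy balance of the spatial terms. -/
lemma sum_spatial_le {τ b3 hx hy : ℝ} {Mx My N s : ℕ} (hτ : 0 < τ) (hMx : 1 ≤ Mx) (hMy : 1 ≤ My)
    {d β : ℕ → ℝ} (hdβ : ∀ r ∈ Finset.Icc 1 s, 0 < d r ∧ 0 < β r ∧ β r < 1)
    {U : ℕ → ℕ → ℕ → ℝ}
    (hbd : ∀ n ≤ N, ∀ i j : ℕ, (i = 0 ∨ i = Mx ∨ j = 0 ∨ j = My) → U n i j = 0) :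
    ∑ i ∈ Finset.Icc 1 (Mx - 1), ∑ j ∈ Finset.Icc 1 (My - 1), ∑ n ∈ Finset.Icc 1 N,
      2 * τ * ((U n i j - U (n - 1) i j) / τ) *
        (b3 * discLap hx hy (fun i' j' => (U n i' j' + U (n - 1) i' j') / 2) i j
          + ∑ r ∈ Finset.Icc 1 s, d r * (τ ^ (1 - β r) / Real.Gamma (2 - β r)) *
            ∑ k ∈ Finset.Icc 1 n, cC (β r) n (n - k) *
              discLap hx hy (fun i' j' => (U k i' j' - U (k - 1) i' j') / τ) i j)
      ≤ -(b3 * (dirichletForm hx hy Mx My (U N) (U N) - dirichletForm hx hy Mx My (U 0) (U 0))) := by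
  set V : ℕ → ℕ → ℕ → ℝ := fun n i j => (U n i j - U (n - 1) i j) / τ with hV
  have hVbd : ∀ n ≤ N, ∀ i j : ℕ, (i = 0 ∨ i = Mx ∨ j = 0 ∨ j = My) → V n i j = 0 := by
    intro n hn i j hij
    simp only [hV]
    rw [hbd n hn i j hij, hbd (n - 1) (by omega) i j hij]
    simp
  have green : ∀ n ∈ Finset.Icc 1 N, ∀ w : ℕ → ℕ → ℝ,
      ∑ i ∈ Finset.Icc 1 (Mx - 1), ∑ j ∈ Finset.Icc 1 (My - 1), discLap hx hy w i j * V n i j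
        = -dirichletForm hx hy Mx My w (V n) := fun n hn w =>
    sum_discLap_mul hx hy Mx My hMx hMy w (V n) (hVbd n (Finset.mem_Icc.1 hn).2)
  have hlevel : ∀ n ∈ Finset.Icc 1 N,
      ∑ i ∈ Finset.Icc 1 (Mx - 1), ∑ j ∈ Finset.Icc 1 (My - 1), 2 * τ * V n i j *
        (b3 * discLap hx hy (fun i' j' => (U n i' j' + U (n - 1) i' j') / 2) i j
          + ∑ r ∈ Finset.Icc 1 s, d r * (τ ^ (1 - β r) / Real.Gamma (2 - β r)) *
            ∑ k ∈ Finset.Icc 1 n, cC (β r) n (n - k) * discLap hx hy (V k) i j)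
      = -(b3 * (dirichletForm hx hy Mx My (U n) (U n)
            - dirichletForm hx hy Mx My (U (n - 1)) (U (n - 1))))
        - ∑ r ∈ Finset.Icc 1 s, 2 * τ * (d r * (τ ^ (1 - β r) / Real.Gamma (2 - β r))) *
            ∑ k ∈ Finset.Icc 1 n, cC (β r) n (n - k) * dirichletForm hx hy Mx My (V k) (V n) := by
    intro n hn
    have e1 : ∑ i ∈ Finset.Icc 1 (Mx - 1), ∑ j ∈ Finset.Icc 1 (My - 1), 2 * τ * V n i j *
          (b3 * discLap hx hy (fun i' j' => (U n i' j' + U (n - 1) i' j') / 2) i j)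
        = -(b3 * (dirichletForm hx hy Mx My (U n) (U n)
            - dirichletForm hx hy Mx My (U (n - 1)) (U (n - 1)))) := by
      rw [← dirichletForm_avg_diff hx hy τ Mx My _ _ hτ.ne']
      have := green n hn (fun i' j' => (U n i' j' + U (n - 1) i' j') / 2)
      calc _ = 2 * τ * b3 * ∑ i ∈ Finset.Icc 1 (Mx - 1), ∑ j ∈ Finset.Icc 1 (My - 1),
            discLap hx hy (fun i' j' => (U n i' j' + U (n - 1) i' j') / 2) i j * V n i j := by
              simp only [Finset.mul_sum]
              exact Finset.sum_congr rfl fun i _ => Finset.sum_congr rfl fun j _ => by ring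
        _ = _ := by rw [this]; ring
    have e2 : ∑ i ∈ Finset.Icc 1 (Mx - 1), ∑ j ∈ Finset.Icc 1 (My - 1), 2 * τ * V n i j *
          (∑ r ∈ Finset.Icc 1 s, d r * (τ ^ (1 - β r) / Real.Gamma (2 - β r)) *
            ∑ k ∈ Finset.Icc 1 n, cC (β r) n (n - k) * discLap hx hy (V k) i j)
        = -∑ r ∈ Finset.Icc 1 s, 2 * τ * (d r * (τ ^ (1 - β r) / Real.Gamma (2 - β r))) *
            ∑ k ∈ Finset.Icc 1 n, cC (β r) n (n - k) * dirichletForm hx hy Mx My (V k) (V n) := by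
      calc _ = ∑ r ∈ Finset.Icc 1 s, ∑ k ∈ Finset.Icc 1 n,
            2 * τ * (d r * (τ ^ (1 - β r) / Real.Gamma (2 - β r))) * cC (β r) n (n - k) *
              ∑ i ∈ Finset.Icc 1 (Mx - 1), ∑ j ∈ Finset.Icc 1 (My - 1),
                discLap hx hy (V k) i j * V n i j := by
              simp only [Finset.mul_sum]
              simp only [Finset.sum_comm (s := Finset.Icc 1 (My - 1)) (t := Finset.Icc 1 s),
                Finset.sum_comm (s := Finset.Icc 1 (My - 1)) (t := Finset.Icc 1 n)]
              rw [Finset.sum_comm]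
              refine Finset.sum_congr rfl fun r _ => ?_
              rw [Finset.sum_comm]
              exact Finset.sum_congr rfl fun k _ => Finset.sum_congr rfl fun i _ =>
                Finset.sum_congr rfl fun j _ => by ring
        _ = _ := by
              simp only [green n hn, Finset.mul_sum, ← Finset.sum_neg_distrib]
              exact Finset.sum_congr rfl fun r _ => Finset.sum_congr rfl fun k _ => by ring
    simp only [mul_add, Finset.sum_add_distrib] at e1 e2 ⊢
    rw [e1, e2]
    ring
  have hmem : 0 ≤ ∑ n ∈ Finset.Icc 1 N, ∑ r ∈ Finset.Icc 1 s,
      2 * τ * (d r * (τ ^ (1 - β r) / Real.Gamma (2 - β r))) *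
        ∑ k ∈ Finset.Icc 1 n, cC (β r) n (n - k) * dirichletForm hx hy Mx My (V k) (V n) := by
    rw [Finset.sum_comm]
    refine Finset.sum_nonneg fun r hr => ?_
    obtain ⟨hd, hβ0, hβ1⟩ := hdβ r hr
    have hG := Real.Gamma_pos_of_pos (show 0 < 2 - β r by linarith)
    rw [← Finset.mul_sum]
    exact mul_nonneg (by positivity) (sum_cC_dirichletForm_nonneg hβ0 hβ1 hx hy Mx My N V)
  have hswap : ∀ F : ℕ → ℕ → ℕ → ℝ,
      ∑ i ∈ Finset.Icc 1 (Mx - 1), ∑ j ∈ Finset.Icc 1 (My - 1), ∑ n ∈ Finset.Icc 1 N, F i j n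
        = ∑ n ∈ Finset.Icc 1 N, ∑ i ∈ Finset.Icc 1 (Mx - 1), ∑ j ∈ Finset.Icc 1 (My - 1),
          F i j n := by
    intro F
    rw [Finset.sum_comm (s := Finset.Icc 1 N)]
    exact Finset.sum_congr rfl fun i _ => Finset.sum_comm
  rw [hswap, Finset.sum_congr rfl hlevel, Finset.sum_sub_distrib, Finset.sum_neg_distrib,
    ← Finset.mul_sum, sum_Icc_one_sub_pred (fun n => dirichletForm hx hy Mx My (U n) (U n))]
  linarith

/-- Theorem 2 (unconditional stability of the implicit finite difference scheme):
any solution `U` of the scheme satisfies the a priori energy estimate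
`b₂‖U^N‖₀² + b₃|U^N|₁² ≤ b₂‖U⁰‖₀² + b₃|U⁰|₁² + ∑_l (a_l T^{2-γ_l}/Γ(3-γ_l))‖φ‖₀²
  + (T/(∑_l a_l T^{1-γ_l}/Γ(2-γ_l) + 2b₁)) max_n ‖f^{n-1/2}‖₀²`. -/
theorem scheme_unconditionally_stable
    (Lx Ly T : ℝ) (hLx : 0 < Lx) (hLy : 0 < Ly) (hT : 0 < T)
    (Mx My N : ℕ) (hMx : 1 ≤ Mx) (hMy : 1 ≤ My) (hN : 1 ≤ N)
    (hx hy τ : ℝ) (hhx : hx = Lx / Mx) (hhy : hy = Ly / My) (hτ : τ = T / N)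
    (p q s : ℕ) (hp : 1 ≤ p) (hq : 1 ≤ q) (hs : 1 ≤ s)
    (a γ : ℕ → ℝ) (haγ : ∀ l ∈ Finset.Icc 1 p, 0 < a l ∧ 1 < γ l ∧ γ l < 2)
    (b1 b2 b3 : ℝ) (hb1 : 0 < b1) (hb2 : 0 < b2) (hb3 : 0 < b3)
    (c α : ℕ → ℝ) (hcα : ∀ m ∈ Finset.Icc 1 q, 0 < c m ∧ 0 < α m ∧ α m < 1)
    (d β : ℕ → ℝ) (hdβ : ∀ r ∈ Finset.Icc 1 s, 0 < d r ∧ 0 < β r ∧ β r < 1)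
    (U : ℕ → ℕ → ℕ → ℝ) (φ : ℕ → ℕ → ℝ) (f : ℕ → ℕ → ℕ → ℝ)
    (hbd : ∀ n ≤ N, ∀ i j : ℕ, (i = 0 ∨ i = Mx ∨ j = 0 ∨ j = My) → U n i j = 0)
    (hscheme : ∀ n ∈ Finset.Icc 1 N, ∀ i ∈ Finset.Icc 1 (Mx - 1), ∀ j ∈ Finset.Icc 1 (My - 1),
      (∑ l ∈ Finset.Icc 1 p, a l * (τ ^ (1 - γ l) / Real.Gamma (3 - γ l)) *
          (aG (γ l) 0 * ((U n i j - U (n - 1) i j) / τ)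
            - (∑ k ∈ Finset.Icc 1 (n - 1),
                (aG (γ l) (n - k - 1) - aG (γ l) (n - k)) * ((U k i j - U (k - 1) i j) / τ))
            - aG (γ l) (n - 1) * φ i j))
        + b1 * ((U n i j - U (n - 1) i j) / τ)
        + (∑ m ∈ Finset.Icc 1 q, c m * (τ ^ (1 - α m) / Real.Gamma (2 - α m)) *
            ∑ k ∈ Finset.Icc 1 n, cC (α m) n (n - k) * ((U k i j - U (k - 1) i j) / τ))
        + b2 * ((U n i j + U (n - 1) i j) / 2)
      = b3 * discLap hx hy (fun i' j' => (U n i' j' + U (n - 1) i' j') / 2) i j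
        + (∑ r ∈ Finset.Icc 1 s, d r * (τ ^ (1 - β r) / Real.Gamma (2 - β r)) *
            ∑ k ∈ Finset.Icc 1 n, cC (β r) n (n - k) *
              discLap hx hy (fun i' j' => (U k i' j' - U (k - 1) i' j') / τ) i j)
        + f n i j) :
    b2 * norm0sq hx hy Mx My (U N) + b3 * semi1sq hx hy Mx My (U N)
      ≤ b2 * norm0sq hx hy Mx My (U 0) + b3 * semi1sq hx hy Mx My (U 0)
        + (∑ l ∈ Finset.Icc 1 p,
            a l * T ^ (2 - γ l) / Real.Gamma (3 - γ l)) * norm0sq hx hy Mx My φ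
        + (T / ((∑ l ∈ Finset.Icc 1 p, a l * T ^ (1 - γ l) / Real.Gamma (2 - γ l)) + 2 * b1)) *
            (Finset.Icc 1 N).sup' (Finset.nonempty_Icc.mpr hN)
              (fun n => norm0sq hx hy Mx My (f n)) := by
  have hNpos : (0 : ℝ) < N := by exact_mod_cast hN
  have hτpos : 0 < τ := by rw [hτ]; positivity
  have hxy : 0 ≤ hx * hy := by rw [hhx, hhy]; positivity
  set K := (∑ l ∈ Finset.Icc 1 p, a l * T ^ (1 - γ l) / Real.Gamma (2 - γ l)) + 2 * b1 with hKdef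
  have hK : 0 < K := by
    have : 0 ≤ ∑ l ∈ Finset.Icc 1 p, a l * T ^ (1 - γ l) / Real.Gamma (2 - γ l) :=
      Finset.sum_nonneg fun l hl => by
        obtain ⟨ha, hγ1, hγ2⟩ := haγ l hl
        have := Real.Gamma_pos_of_pos (show 0 < 2 - γ l by linarith)
        positivity
    linarith
  set Φ := ∑ l ∈ Finset.Icc 1 p, a l * T ^ (2 - γ l) / Real.Gamma (3 - γ l) with hΦ
  set S := (Finset.Icc 1 N).sup' (Finset.nonempty_Icc.mpr hN)
    (fun n => norm0sq hx hy Mx My (f n)) with hS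
  have hpoint := Finset.sum_le_sum fun i (hi : i ∈ Finset.Icc 1 (Mx - 1)) =>
    Finset.sum_le_sum fun j (hj : j ∈ Finset.Icc 1 (My - 1)) =>
      pointwise_energy (u := fun n => U n i j) (f := fun n => f n i j) hT hN hτ hb1 haγ hcα
        (fun _ => rfl) (fun n hn => hscheme n hn i hi j hj)
  have hspace := sum_spatial_le (b3 := b3) (hx := hx) (hy := hy) hτpos hMx hMy hdβ hbd
  rw [← hKdef, ← hΦ] at hpoint
  simp only [Finset.sum_add_distrib, ← Finset.mul_sum, Finset.sum_sub_distrib] at hpoint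
  have hf : hx * hy * ∑ i ∈ Finset.Icc 1 (Mx - 1), ∑ j ∈ Finset.Icc 1 (My - 1),
      ∑ n ∈ Finset.Icc 1 N, f n i j ^ 2 ≤ N * S := by
    have e : hx * hy * ∑ i ∈ Finset.Icc 1 (Mx - 1), ∑ j ∈ Finset.Icc 1 (My - 1),
        ∑ n ∈ Finset.Icc 1 N, f n i j ^ 2 = ∑ n ∈ Finset.Icc 1 N, norm0sq hx hy Mx My (f n) := by
      simp only [norm0sq]
      rw [← Finset.mul_sum, Finset.sum_comm (s := Finset.Icc 1 N)]
      congr 1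
      exact Finset.sum_congr rfl fun i _ => Finset.sum_comm
    rw [e]
    have h := Finset.sum_le_card_nsmul (Finset.Icc 1 N) (fun n => norm0sq hx hy Mx My (f n)) S
      (fun n hn => Finset.le_sup' (fun n => norm0sq hx hy Mx My (f n)) hn)
    simpa using h
  have hfK := mul_le_mul_of_nonneg_left hf (show 0 ≤ τ / K by positivity)
  have hTK : τ / K * (N * S) = T / K * S := by rw [hτ]; field_simp
  rw [hTK] at hfK
  have hgrid := mul_le_mul_of_nonneg_left
    (hpoint.trans (add_le_add_right hspace _)) hxy
  rw [semi1sq_eq_dirichletForm, semi1sq_eq_dirichletForm]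
  simp only [norm0sq]
  linear_combination hgrid + hfK
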